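/- Let A be a time-reversal invariant abelian bosonic topological order (finite abelian group with nondegenerate symmetric bilinear form θ, topological spins θ_• with θ_{ab}=θ_a+θ_b+θ(a,b), and an automorphism T with T²=id, θ_{Ta}=−θ_a). If A contains an element a of order n, then |A| = (kn)² for some positive integer k; in particular |A| ≥ n². -/

import Mathlib

namespace TRAux

variable {A : Type*} [CommGroup A] [Finite A]

/-- annihilator of a subgroup -/
noncomputable def perp (B : A →* (A →* ℂˣ)) (S : Subgroup A) : Subgroup A :=
  ((MonoidHom.domRestrictHom S ℂˣ).comp B).ker

lemma mem_perp (B : A →* (A →* ℂˣ)) (S : Subgroup A) (x : A) :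
    x ∈ perp B S ↔ ∀ s ∈ S, B x s = 1 := by
  unfold perp
  rw [MonoidHom.mem_ker, MonoidHom.comp_apply, MonoidHom.domRestrictHom_apply,
    MonoidHom.domRestrict_eq_one_iff]

lemma surj (B : A →* (A →* ℂˣ)) (hB : Function.Injective B) : Function.Surjective B := by
  have : NeZero (Monoid.exponent A) := ⟨Monoid.exponent_ne_zero_of_finite⟩
  have h := CommGroup.card_monoidHom_of_hasEnoughRootsOfUnity A ℂ
  have : Finite (A →* ℂˣ) := Nat.finite_of_card_ne_zero (by rw [h]; exact Nat.card_pos.ne')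
  exact ((Nat.bijective_iff_injective_and_card _).mpr ⟨hB, h.symm⟩).2

lemma card_perp (B : A →* (A →* ℂˣ)) (hB : Function.Injective B) (S : Subgroup A) :
    Nat.card A = Nat.card S * Nat.card (perp B S) := by
  have : NeZero (Monoid.exponent A) := ⟨Monoid.exponent_ne_zero_of_finite⟩
  have : NeZero (Monoid.exponent S) := ⟨Monoid.exponent_ne_zero_of_finite⟩
  have hs : Function.Surjective ((MonoidHom.domRestrictHom S ℂˣ).comp B) := by
    rw [MonoidHom.coe_comp]
    exact (MonoidHom.domRestrict_surjective ℂ S).comp (surj B hB)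
  rw [← (perp B S).card_mul_index, mul_comm]
  congr 1
  unfold perp
  rw [Subgroup.index_ker, MonoidHom.range_eq_top.mpr hs, Subgroup.card_top,
    CommGroup.card_monoidHom_of_hasEnoughRootsOfUnity]

lemma square (B : A →* (A →* ℂˣ)) (hB : Function.Injective B)
    (hskew : ∀ x y, B x y * B y x = 1) (w : A) (hw : ∀ x, B x x = B x w) (hww : B w w = 1) :
    ∃ m, Nat.card A = m ^ 2 := by
  have h0 : ∀ x ∈ Subgroup.zpowers w, ∀ y ∈ Subgroup.zpowers w, B x y = 1 := by
    rintro x ⟨i, rfl⟩ y ⟨j, rfl⟩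
    simp [hww]
  obtain ⟨L, hwL, hL⟩ := Set.Finite.exists_le_maximal
    (Set.toFinite {L : Subgroup A | ∀ x ∈ L, ∀ y ∈ L, B x y = 1}) h0
  have hwm : w ∈ L := hwL (Subgroup.mem_zpowers w)
  have hiso : ∀ x ∈ L, ∀ y ∈ L, B x y = 1 := hL.prop
  have hp : perp B L = L := by
    apply le_antisymm
    · intro x hx
      rw [mem_perp] at hx
      have hx' : ∀ s ∈ L, B s x = 1 := fun s hs => by
        have := hskew x s
        rwa [hx s hs, one_mul] at this
      have hxx : B x x = 1 := by rw [hw, hx w hwm]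
      have hM : ∀ u ∈ L ⊔ Subgroup.zpowers x, ∀ v ∈ L ⊔ Subgroup.zpowers x, B u v = 1 := by
        intro u hu v hv
        obtain ⟨l, hl, _, ⟨i, rfl⟩, rfl⟩ := Subgroup.mem_sup.mp hu
        obtain ⟨k, hk, _, ⟨j, rfl⟩, rfl⟩ := Subgroup.mem_sup.mp hv
        simp [hiso l hl k hk, hx k hk, hx' l hl, hxx]
      exact hL.le_of_ge hM le_sup_left (le_sup_right (a := L) (Subgroup.mem_zpowers x))
    · intro x hx
      rw [mem_perp]
      exact hiso x hx
  refine ⟨Nat.card L, ?_⟩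
  have := card_perp B hB L
  rw [hp] at this
  rw [this, sq]

lemma sq_dvd (B : A →* (A →* ℂˣ)) (hB : Function.Injective B)
    (hskew : ∀ x y, B x y * B y x = 1) (a : A) : orderOf a ^ 2 ∣ 2 * Nat.card A := by
  have h1 : a ^ 2 ∈ perp B (Subgroup.zpowers a) := by
    rw [mem_perp]
    rintro _ ⟨j, rfl⟩
    have h : (B a a) ^ 2 = 1 := by rw [sq]; exact hskew a a
    have : B (a ^ 2) a = 1 := by simpa using h
    simp only [map_zpow, this, one_zpow]
  have h2 : orderOf (a ^ 2) ∣ Nat.card (perp B (Subgroup.zpowers a)) := by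
    rw [← Nat.card_zpowers]
    exact Subgroup.card_dvd_of_le (Subgroup.zpowers_le.mpr h1)
  have h3 : orderOf a ∣ 2 * orderOf (a ^ 2) := by
    apply orderOf_dvd_of_pow_eq_one
    rw [pow_mul, pow_orderOf_eq_one]
  rw [card_perp B hB (Subgroup.zpowers a), Nat.card_zpowers, sq, mul_left_comm]
  exact mul_dvd_mul_left _ (h3.trans (mul_dvd_mul_left _ h2))

lemma dvd_of_sq (n m : ℕ) (hm : 0 < m) (h : n ^ 2 ∣ 2 * m ^ 2) : n ∣ m := by
  obtain ⟨n', m', hc, hn, hm'⟩ := Nat.exists_coprime n m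
  have hg : 0 < Nat.gcd n m := Nat.gcd_pos_of_pos_right _ hm
  have h1 : n' ^ 2 ∣ 2 := by
    have h2 : n' ^ 2 * (Nat.gcd n m) ^ 2 ∣ (2 * m' ^ 2) * (Nat.gcd n m) ^ 2 := by
      rw [← mul_pow, mul_assoc, ← mul_pow, ← hn, ← hm']; exact h
    exact (Nat.Coprime.pow 2 2 hc).dvd_of_dvd_mul_right
      (Nat.dvd_of_mul_dvd_mul_right (pow_pos hg 2) h2)
  have h3 : n' = 1 := by
    have := Nat.le_of_dvd two_pos h1
    have h4 : n' < 2 := by nlinarith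
    have h5 : n' ≠ 0 := by
      intro h6
      rw [h6] at h1
      norm_num at h1
    omega
  rw [h3, one_mul] at hn
  rw [hn]
  exact Nat.gcd_dvd_right n m

lemma exists_char (B : A →* (A →* ℂˣ)) (hB : Function.Injective B)
    (hskew : ∀ x y, B x y * B y x = 1) : ∃ v, ∀ x, B v x = B x x := by
  obtain ⟨v, hv⟩ := surj B hB (MonoidHom.mk' (fun x => B x x) (fun x y => by
    have h := hskew x y
    simp only [map_mul, MonoidHom.mul_apply]
    generalize B x x = p at *
    generalize B y y = q at *
    generalize B x y = r at *
    generalize B y x = t at *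
    calc p * t * (r * q) = p * q * (r * t) := by
          rw [mul_comm r q, mul_mul_mul_comm, mul_comm t r]
      _ = _ := by rw [h, mul_one]))
  exact ⟨v, fun x => by rw [hv]; rfl⟩

end TRAux


/-- In a time-reversal invariant abelian bosonic topological order containing an element
`a` of order `n`, the anyon count is `|A| = (kn)²` for some positive integer `k`;
in particular `|A| ≥ n²`. -/
theorem card_eq_mul_order_sq {A : Type*} [CommGroup A] [Fintype A]
    (θ : A → A → Real.Angle) (θs : A → Real.Angle)
    (hsymm : ∀ a b : A, θ a b = θ b a)
    (hbil : ∀ a b d : A, θ (a * b) d = θ a d + θ b d)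
    (hnd : ∀ a : A, (∀ b : A, θ a b = 0) → a = 1)
    (hquad : ∀ a : A, θ a a = θs a + θs a)
    (hrel : ∀ a b : A, θs (a * b) = θs a + θs b + θ a b)
    (T : A → A)
    (hThom : ∀ a b : A, T (a * b) = T a * T b)
    (hT2 : ∀ a : A, T (T a) = a)
    (hTθ : ∀ a b : A, θ (T a) (T b) = - θ a b)
    (hTs : ∀ a : A, θs (T a) = - θs a)
    (a : A) (n : ℕ) (hn : orderOf a = n) :
    (∃ k : ℕ, 0 < k ∧ Nat.card A = (k * n) ^ 2) ∧ n ^ 2 ≤ Nat.card A := by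
  have hbil2 : ∀ a b d : A, θ d (a * b) = θ d a + θ d b := fun a b d => by
    rw [hsymm, hbil, hsymm a, hsymm b]
  have hz1 : ∀ d, θ 1 d = 0 := fun d => by simpa using hbil 1 1 d
  have hz2 : ∀ d, θ d 1 = 0 := fun d => by rw [hsymm, hz1]
  have hT1 : T 1 = 1 := by simpa using hThom 1 1
  let e : Real.Angle → ℂˣ := fun t => Circle.toUnits t.toCircle
  have he0 : e 0 = 1 := by simp [e]
  have hea : ∀ s t, e (s + t) = e s * e t := fun s t => by
    simp only [e, Real.Angle.toCircle_add, map_mul]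
  have hei : ∀ s t, e s = e t → s = t := fun s t h => by
    have h1 : (s.toCircle : ℂ) = t.toCircle := congrArg Units.val h
    rw [← Real.Angle.arg_toCircle s, ← Real.Angle.arg_toCircle t, h1]
  let B : A →* (A →* ℂˣ) := MonoidHom.mk' (fun x =>
      MonoidHom.mk' (fun y => e (θ x (T y))) (fun y z => by rw [hThom, hbil2, hea]))
    (fun x y => by ext1 z; exact (congrArg e (hbil x y (T z))).trans (hea _ _))
  have hBv : ∀ x y, B x y = e (θ x (T y)) := fun _ _ => rfl
  have hB : Function.Injective B := by
    rw [injective_iff_map_eq_one]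
    intro x hx
    refine hnd x (fun y => hei _ _ ?_)
    have := hBv x (T y)
    rw [hx, hT2] at this
    rw [he0, ← this]; rfl
  have hsk : ∀ x y, θ y (T x) = - θ x (T y) := fun x y => by
    rw [hsymm, ← hT2 y, hTθ, hT2]
  have hskew : ∀ x y, B x y * B y x = 1 := fun x y => by
    rw [hBv, hBv, ← hea, hsk x y, add_neg_cancel, he0]
  obtain ⟨v, hDv⟩ := TRAux.exists_char B hB hskew
  have hθv : ∀ x, θ v (T x) = θ x (T x) := fun x => hei _ _ (hDv x)
  have hTv : T v = v := by
    have h1 : ∀ x, θ (T v) x = θ v x := fun x => by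
      have h2 := hθv (T x)
      have h3 := hTθ v (T x)
      have h4 := hθv x
      rw [hT2] at h2 h3
      have h5 : θ v (T x) = - θ x (T x) := by rw [h4]; exact hsk x x
      rw [h3, h5, neg_neg, h2, hsymm]
    apply hB
    ext1 x
    rw [hBv, hBv, h1]
  have hvv : B v v = 1 := by
    rw [hBv, hTv, hquad]
    nth_rewrite 1 [← hTv]
    rw [hTs, neg_add_cancel, he0]
  have hsymD : ∀ x, B x x = B x v := fun x => by
    have h1 := hskew x v
    have h2 := hskew x x
    rw [hDv] at h1
    exact mul_right_cancel (h2.trans h1.symm)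
  obtain ⟨m, hm⟩ := TRAux.square B hB hskew v hsymD hvv
  have hpos : 0 < Nat.card A := Nat.card_pos
  have hm0 : 0 < m := by
    rcases Nat.eq_zero_or_pos m with h | h
    · rw [hm, h] at hpos; simp at hpos
    · exact h
  have hd := TRAux.sq_dvd B hB hskew a
  rw [hn, hm] at hd
  have hnm := TRAux.dvd_of_sq n m hm0 hd
  obtain ⟨k, rfl⟩ := hnm
  refine ⟨⟨k, Nat.pos_of_ne_zero (by rintro rfl; simp at hm0), by rw [hm, mul_comm]⟩, ?_⟩
  rw [hm]
  exact Nat.pow_le_pow_left (Nat.le_of_dvd hm0 (dvd_mul_right _ _)) 2
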